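/- Suppose d ≤ 2 and fix P ∈ 𝔓_+. Then the map f^p : 𝔓_+ → ℭ_+ defined component-wise by (f^p(Q))_k = ∫_{𝕋^d} e^{i(k,θ)} (P/Q) dm for k ∈ Λ is well defined (its values lie in ℭ_+) and is a diffeomorphism: a smooth bijection from 𝔓_+ onto ℭ_+ with smooth inverse, where 𝔓_+ and ℭ_+ are regarded as open subsets of the real vector space of conjugate-symmetric coefficient sequences indexed by Λ (isomorphic to ℝ^{|Λ|}). -/

import Mathlib

open MeasureTheory Complex Set

noncomputable section

namespace RCE

/-- The scalar product (k,θ) = Σⱼ kⱼ θⱼ. -/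
def dotP (d : ℕ) (k : Fin d → ℤ) (θ : Fin d → ℝ) : ℝ := ∑ j, (k j : ℝ) * θ j

/-- The d-dimensional torus 𝕋^d = (−π,π]^d. -/
def Td (d : ℕ) : Set (Fin d → ℝ) := Set.univ.pi fun _ => Set.Ioc (-Real.pi) Real.pi

/-- Normalized Lebesgue measure dm = (2π)^{-d} dθ on 𝕋^d. -/
def dm (d : ℕ) : Measure (Fin d → ℝ) :=
  (ENNReal.ofReal ((2 * Real.pi) ^ d))⁻¹ • (volume.restrict (Td d))

/-- Conjugate symmetry of a coefficient sequence indexed by Λ. -/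
def symmE (d : ℕ) (Λ : Finset (Fin d → ℤ)) (p : {k // k ∈ Λ} → ℂ) : Prop :=
  ∀ (k : {k // k ∈ Λ}) (h : -(k : Fin d → ℤ) ∈ Λ),
    p ⟨-(k : Fin d → ℤ), h⟩ = starRingEnd ℂ (p k)

/-- Evaluation of the trigonometric polynomial P(e^{iθ}) = Σ_{k∈Λ} p_k e^{-i(k,θ)}. -/
def evalE (d : ℕ) (Λ : Finset (Fin d → ℤ)) (p : {k // k ∈ Λ} → ℂ)
    (θ : Fin d → ℝ) : ℝ :=
  (∑ k : {k // k ∈ Λ}, p k * Complex.exp (-(dotP d (k : Fin d → ℤ) θ : ℂ) * Complex.I)).re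

/-- `𝔓₊` inside the finite-dimensional coefficient space. -/
def PplusE (d : ℕ) (Λ : Finset (Fin d → ℤ)) : Set ({k // k ∈ Λ} → ℂ) :=
  {p | symmE d Λ p ∧ ∀ θ ∈ Td d, 0 < evalE d Λ p θ}

/-- `𝔓̄₊` inside the finite-dimensional coefficient space. -/
def PbarE (d : ℕ) (Λ : Finset (Fin d → ℤ)) : Set ({k // k ∈ Λ} → ℂ) :=
  {p | symmE d Λ p ∧ ∀ θ ∈ Td d, 0 ≤ evalE d Λ p θ}

/-- The pairing ⟨c,p⟩. -/
def pairE (d : ℕ) (Λ : Finset (Fin d → ℤ)) (c p : {k // k ∈ Λ} → ℂ) : ℝ :=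
  (∑ k : {k // k ∈ Λ}, c k * starRingEnd ℂ (p k)).re

/-- `ℭ₊` inside the finite-dimensional coefficient space. -/
def CplusE (d : ℕ) (Λ : Finset (Fin d → ℤ)) : Set ({k // k ∈ Λ} → ℂ) :=
  {c | symmE d Λ c ∧ ∀ p ∈ PbarE d Λ, p ≠ 0 → 0 < pairE d Λ c p}

/-- The moment map f^p : Q ↦ c, (f^p(Q))_k = ∫ e^{i(k,θ)} (P/Q)(e^{iθ}) dm(θ). -/
def fpE (d : ℕ) (Λ : Finset (Fin d → ℤ)) (P : {k // k ∈ Λ} → ℂ)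
    (Q : {k // k ∈ Λ} → ℂ) : {k // k ∈ Λ} → ℂ :=
  fun k => ∫ θ, Complex.exp ((dotP d (k : Fin d → ℤ) θ : ℂ) * Complex.I) *
    ((evalE d Λ P θ / evalE d Λ Q θ : ℝ) : ℂ) ∂(dm d)

open scoped BoundedContinuousFunction Topology

/-- The real vector space of all coefficient vectors indexed by `Λ`. -/
abbrev Coeff (d : ℕ) (Λ : Finset (Fin d → ℤ)) : Type := {k // k ∈ Λ} → ℂ

variable {d : ℕ} {Λ : Finset (Fin d → ℤ)}

@[fun_prop]
lemma continuous_dotP (k : Fin d → ℤ) : Continuous (dotP d k) := by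
  unfold dotP; fun_prop

lemma dotP_add (k : Fin d → ℤ) (θ η : Fin d → ℝ) : dotP d k (θ + η) = dotP d k θ + dotP d k η := by
  simp [dotP, mul_add, Finset.sum_add_distrib]

lemma dotP_neg_right (k : Fin d → ℤ) (θ : Fin d → ℝ) : dotP d k (-θ) = -dotP d k θ := by
  simp [dotP]

lemma dotP_neg_left (k : Fin d → ℤ) (θ : Fin d → ℝ) : dotP d (-k) θ = -dotP d k θ := by
  simp [dotP]

lemma dotP_sub_left (k l : Fin d → ℤ) (θ : Fin d → ℝ) :
    dotP d (k - l) θ = dotP d k θ - dotP d l θ := by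
  simp [dotP, sub_mul]

lemma abs_dotP_le (k : Fin d → ℤ) (θ : Fin d → ℝ) :
    |dotP d k θ| ≤ (∑ j, |(k j : ℝ)|) * ‖θ‖ := by
  rw [Finset.sum_mul]
  refine (Finset.abs_sum_le_sum_abs _ _).trans (Finset.sum_le_sum fun j _ => ?_)
  rw [abs_mul]
  gcongr
  exact norm_le_pi_norm θ j

/-- The trigonometric polynomial written with cosines and sines. -/
lemma evalE_eq (p : Coeff d Λ) (θ : Fin d → ℝ) :
    evalE d Λ p θ = ∑ k : {k // k ∈ Λ},
      ((p k).re * Real.cos (dotP d k θ) + (p k).im * Real.sin (dotP d k θ)) := by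
  unfold evalE
  rw [Complex.re_sum]
  refine Finset.sum_congr rfl fun k _ => ?_
  rw [← Complex.ofReal_neg, Complex.mul_re, Complex.exp_ofReal_mul_I_re,
    Complex.exp_ofReal_mul_I_im]
  simp

lemma continuous_evalE_uncurry :
    Continuous fun x : Coeff d Λ × (Fin d → ℝ) => evalE d Λ x.1 x.2 := by
  simp only [evalE_eq]
  fun_prop

lemma continuous_evalE_left (θ : Fin d → ℝ) : Continuous fun p : Coeff d Λ => evalE d Λ p θ :=
  continuous_evalE_uncurry.comp (by fun_prop : Continuous fun p : Coeff d Λ => (p, θ))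

lemma continuous_evalE (p : Coeff d Λ) : Continuous (evalE d Λ p) := by
  simp only [funext (evalE_eq p)]
  fun_prop

lemma evalE_add (p q : Coeff d Λ) (θ : Fin d → ℝ) :
    evalE d Λ (p + q) θ = evalE d Λ p θ + evalE d Λ q θ := by
  simp only [evalE_eq, ← Finset.sum_add_distrib, Pi.add_apply, Complex.add_re, Complex.add_im]
  exact Finset.sum_congr rfl fun k _ => by ring

lemma evalE_smul (a : ℝ) (p : Coeff d Λ) (θ : Fin d → ℝ) :
    evalE d Λ (a • p) θ = a * evalE d Λ p θ := by
  simp only [evalE_eq, Finset.mul_sum, Pi.smul_apply, Complex.smul_re, Complex.smul_im,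
    smul_eq_mul]
  exact Finset.sum_congr rfl fun k _ => by ring

lemma abs_evalE_le (p : Coeff d Λ) (θ : Fin d → ℝ) : |evalE d Λ p θ| ≤ ∑ k, ‖p k‖ := by
  unfold evalE
  refine (Complex.abs_re_le_norm _).trans ((norm_sum_le _ _).trans (le_of_eq ?_))
  refine Finset.sum_congr rfl fun k _ => ?_
  rw [norm_mul, ← Complex.ofReal_neg, Complex.norm_exp_ofReal_mul_I, mul_one]

/-- The value at every point of `ℝ^d` is attained on the fundamental cell. -/
lemma exists_mem_Td_evalE_eq (θ : Fin d → ℝ) :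
    ∃ η ∈ Td d, ∀ p : Coeff d Λ, evalE d Λ p θ = evalE d Λ p η := by
  have h2 : (0 : ℝ) < 2 * Real.pi := by positivity
  refine ⟨fun j => toIocMod h2 (-Real.pi) (θ j), ?_, ?_⟩
  · intro j _
    have := toIocMod_mem_Ioc h2 (-Real.pi) (θ j)
    rwa [show -Real.pi + 2 * Real.pi = Real.pi by ring] at this
  · intro p
    have key : ∀ k : Fin d → ℤ, dotP d k θ = dotP d k (fun j => toIocMod h2 (-Real.pi) (θ j))
        + ((∑ j, k j * toIocDiv h2 (-Real.pi) (θ j) : ℤ) : ℝ) * (2 * Real.pi) := by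
      intro k
      simp only [dotP]
      push_cast
      rw [Finset.sum_mul, ← Finset.sum_add_distrib]
      refine Finset.sum_congr rfl fun j _ => ?_
      have := toIocMod_add_toIocDiv_zsmul h2 (-Real.pi) (θ j)
      rw [zsmul_eq_mul] at this
      nth_rewrite 1 [← this]
      ring
    simp only [evalE_eq]
    refine Finset.sum_congr rfl fun k _ => ?_
    rw [key k, Real.cos_add_int_mul_two_pi, Real.sin_add_int_mul_two_pi]

lemma evalE_nonneg_of_mem_PbarE {p : Coeff d Λ} (hp : p ∈ PbarE d Λ) (θ : Fin d → ℝ) :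
    0 ≤ evalE d Λ p θ := by
  obtain ⟨η, hη, h⟩ := exists_mem_Td_evalE_eq (Λ := Λ) θ
  exact (h p).symm ▸ hp.2 η hη

/-- Vectors (not necessarily symmetric) whose trigonometric polynomial has positive real part. -/
def posSet (d : ℕ) (Λ : Finset (Fin d → ℤ)) : Set (Coeff d Λ) :=
  {p | ∀ θ : Fin d → ℝ, 0 < evalE d Λ p θ}

lemma mem_posSet_of_Td {p : Coeff d Λ} (hp : ∀ θ ∈ Td d, 0 < evalE d Λ p θ) :
    p ∈ posSet d Λ := by
  intro θ
  obtain ⟨η, hη, h⟩ := exists_mem_Td_evalE_eq (Λ := Λ) θ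
  exact (h p).symm ▸ hp η hη

lemma mem_PplusE_iff {p : Coeff d Λ} : p ∈ PplusE d Λ ↔ symmE d Λ p ∧ p ∈ posSet d Λ :=
  ⟨fun h => ⟨h.1, mem_posSet_of_Td h.2⟩, fun h => ⟨h.1, fun θ _ => h.2 θ⟩⟩

lemma Td_subset_Icc : Td d ⊆ Set.Icc (fun _ => -Real.pi) (fun _ => Real.pi) := by
  intro θ hθ
  exact ⟨fun j => (hθ j trivial).1.le, fun j => (hθ j trivial).2⟩

lemma isOpen_posSet : IsOpen (posSet d Λ) := by
  rw [isOpen_iff_mem_nhds]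
  intro p hp
  have hK : IsCompact (Set.Icc (fun _ : Fin d => -Real.pi) (fun _ => Real.pi)) := isCompact_Icc
  have := hK.eventually_forall_of_forall_eventually (x₀ := p)
    (P := fun q θ => 0 < evalE d Λ q θ) (fun θ _ =>
      (continuous_evalE_uncurry.tendsto (p, θ)).eventually (lt_mem_nhds (hp θ)))
  filter_upwards [this] with q hq
  exact mem_posSet_of_Td fun θ hθ => hq θ (Td_subset_Icc hθ)

lemma exists_lower_bound {p : Coeff d Λ} (hp : p ∈ posSet d Λ) :
    ∃ m > 0, ∀ θ, m ≤ evalE d Λ p θ := by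
  have hK : IsCompact (Set.Icc (fun _ : Fin d => -Real.pi) (fun _ => Real.pi)) := isCompact_Icc
  obtain ⟨η, -, hη⟩ := hK.exists_isMinOn
    (Set.nonempty_Icc.2 fun _ => by linarith [Real.pi_pos]) (continuous_evalE p).continuousOn
  refine ⟨evalE d Λ p η, hp η, fun θ => ?_⟩
  obtain ⟨ξ, hξ, h⟩ := exists_mem_Td_evalE_eq (Λ := Λ) θ
  rw [h p]
  exact hη (Td_subset_Icc hξ)

/-- A trigonometric polynomial as a bounded continuous function, linearly in its coefficients. -/
def evalL (d : ℕ) (Λ : Finset (Fin d → ℤ)) : Coeff d Λ →L[ℝ] ((Fin d → ℝ) →ᵇ ℝ) :=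
  LinearMap.toContinuousLinearMap
    { toFun := fun p => BoundedContinuousFunction.ofNormedAddCommGroup (evalE d Λ p)
        (continuous_evalE p) (∑ k, ‖p k‖) (abs_evalE_le p)
      map_add' := fun p q => by ext θ; exact evalE_add p q θ
      map_smul' := fun a p => by ext θ; exact evalE_smul a p θ }

@[simp]
lemma evalL_apply (p : Coeff d Λ) (θ : Fin d → ℝ) : evalL d Λ p θ = evalE d Λ p θ := rfl

/-- `1/Q` as a bounded continuous function. -/
lemma exists_unit_evalL {q : Coeff d Λ} (hq : q ∈ posSet d Λ) :
    ∃ u : ((Fin d → ℝ) →ᵇ ℝ)ˣ, (u : (Fin d → ℝ) →ᵇ ℝ) = evalL d Λ q ∧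
      ∀ θ, (↑u⁻¹ : (Fin d → ℝ) →ᵇ ℝ) θ = (evalE d Λ q θ)⁻¹ := by
  obtain ⟨m, hm, h⟩ := exists_lower_bound hq
  let v : (Fin d → ℝ) →ᵇ ℝ := BoundedContinuousFunction.ofNormedAddCommGroup
    (fun θ => (evalE d Λ q θ)⁻¹) ((continuous_evalE q).inv₀ fun θ => (hq θ).ne') m⁻¹ (fun θ => by
      rw [norm_inv, Real.norm_of_nonneg (hq θ).le]
      exact inv_anti₀ hm (h θ))
  refine ⟨⟨evalL d Λ q, v, ?_, ?_⟩, rfl, fun θ => rfl⟩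
  · ext θ; exact mul_inv_cancel₀ (hq θ).ne'
  · ext θ; exact inv_mul_cancel₀ (hq θ).ne'

lemma norm_exp_dotP (k : Fin d → ℤ) (θ : Fin d → ℝ) :
    ‖Complex.exp ((dotP d k θ : ℂ) * Complex.I)‖ = 1 := Complex.norm_exp_ofReal_mul_I _

lemma measurableSet_Td : MeasurableSet (Td d) :=
  MeasurableSet.univ_pi fun _ => measurableSet_Ioc

lemma volume_Td : volume (Td d) = ENNReal.ofReal ((2 * Real.pi) ^ d) := by
  rw [Td, Real.volume_pi_Ioc, ENNReal.ofReal_pow (by positivity)]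
  simp [two_mul]

lemma ofReal_two_pi_pow_ne_zero : ENNReal.ofReal ((2 * Real.pi) ^ d) ≠ 0 := by
  rw [ne_eq, ENNReal.ofReal_eq_zero, not_le]; positivity

instance : IsProbabilityMeasure (dm d) where
  measure_univ := by
    rw [dm, Measure.smul_apply, Measure.restrict_apply_univ, volume_Td, smul_eq_mul]
    exact ENNReal.inv_mul_cancel ofReal_two_pi_pow_ne_zero ENNReal.ofReal_ne_top

lemma integral_exp_dm (k : Fin d → ℤ) :
    ∫ θ, Complex.exp ((dotP d k θ : ℂ) * Complex.I) ∂(dm d) = if k = 0 then 1 else 0 := by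
  split_ifs with hk
  · subst hk
    simp [dotP]
  · have h1 : ∀ θ : Fin d → ℝ, Complex.exp ((dotP d k θ : ℂ) * Complex.I)
        = ∏ j, Complex.exp ((k j * Complex.I) * (θ j : ℂ)) := by
      intro θ
      rw [← Complex.exp_sum]
      congr 1
      simp only [dotP]
      push_cast
      rw [Finset.sum_mul]
      exact Finset.sum_congr rfl fun j _ => by ring
    simp only [h1]
    rw [dm, integral_smul_measure, Td, volume_pi, Measure.restrict_pi_pi,
      integral_fintype_prod_eq_prod
        (fun j (x : ℝ) => Complex.exp ((k j * Complex.I) * (x : ℂ)))]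
    obtain ⟨j, hj⟩ := Function.ne_iff.1 hk
    rw [Finset.prod_eq_zero (Finset.mem_univ j), smul_zero]
    rw [← intervalIntegral.integral_of_le (by linarith [Real.pi_pos])]
    have hc : (k j * Complex.I : ℂ) ≠ 0 := by
      have : (k j : ℂ) ≠ 0 := by exact_mod_cast hj
      simp [this]
    rw [integral_exp_mul_complex hc]
    have : Complex.exp (k j * Complex.I * (Real.pi : ℝ))
        = Complex.exp (k j * Complex.I * (-Real.pi : ℝ)) := by
      rw [Complex.exp_eq_exp_iff_exists_int]
      refine ⟨k j, ?_⟩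
      push_cast
      ring
    rw [this, sub_self, zero_div]

lemma integrable_exp_mul (k : Fin d → ℤ) (g : (Fin d → ℝ) →ᵇ ℝ) :
    Integrable (fun θ => Complex.exp ((dotP d k θ : ℂ) * Complex.I) * (g θ : ℂ)) (dm d) := by
  refine Integrable.of_bound (C := ‖g‖) (Continuous.aestronglyMeasurable ?_)
    (Filter.Eventually.of_forall fun θ => ?_)
  · have := g.continuous
    fun_prop
  · rw [norm_mul, norm_exp_dotP, one_mul, Complex.norm_real]
    exact g.norm_coe_le_norm θ

/-- The trigonometric moments of a bounded continuous function. -/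
def momL (d : ℕ) (Λ : Finset (Fin d → ℤ)) : ((Fin d → ℝ) →ᵇ ℝ) →L[ℝ] Coeff d Λ :=
  ContinuousLinearMap.pi fun k => LinearMap.mkContinuous
    { toFun := fun g => ∫ θ, Complex.exp ((dotP d (k : Fin d → ℤ) θ : ℂ) * Complex.I) *
        (g θ : ℂ) ∂(dm d)
      map_add' := fun g h => by
        rw [← integral_add (integrable_exp_mul _ g) (integrable_exp_mul _ h)]
        simp [mul_add]
      map_smul' := fun a g => by
        simp only [RingHom.id_apply, ← integral_smul]
        congr 1
        ext θ
        simp only [BoundedContinuousFunction.coe_smul, smul_eq_mul, Complex.ofReal_mul,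
          Complex.real_smul]
        ring } 1 (fun g => by
      refine (norm_integral_le_of_norm_le_const (C := ‖g‖)
        (Filter.Eventually.of_forall fun θ => ?_)).trans (by simp)
      rw [norm_mul, norm_exp_dotP, one_mul, Complex.norm_real]
      exact g.norm_coe_le_norm θ)

lemma momL_apply (g : (Fin d → ℝ) →ᵇ ℝ) (k : {k // k ∈ Λ}) :
    momL d Λ g k = ∫ θ, Complex.exp ((dotP d (k : Fin d → ℤ) θ : ℂ) * Complex.I) *
      (g θ : ℂ) ∂(dm d) := rfl

lemma symmE_momL (g : (Fin d → ℝ) →ᵇ ℝ) : symmE d Λ (momL d Λ g) := by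
  intro k h
  rw [momL_apply, momL_apply, ← integral_conj]
  congr 1
  ext θ
  rw [map_mul, ← Complex.exp_conj, map_mul, Complex.conj_ofReal, Complex.conj_I,
    Complex.conj_ofReal, dotP_neg_left]
  push_cast
  ring_nf

lemma pairE_momL (g : (Fin d → ℝ) →ᵇ ℝ) (p : Coeff d Λ) :
    pairE d Λ (momL d Λ g) p = ∫ θ, g θ * evalE d Λ p θ ∂(dm d) := by
  unfold pairE
  simp only [momL_apply, ← integral_mul_const]
  rw [← integral_finsetSum _ fun k _ => (integrable_exp_mul _ g).mul_const _]
  have h := integral_re (μ := dm d) (𝕜 := ℂ) (f := fun θ => ∑ k : {k // k ∈ Λ},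
    Complex.exp ((dotP d (k : Fin d → ℤ) θ : ℂ) * Complex.I) * (g θ : ℂ) * starRingEnd ℂ (p k))
    (integrable_finsetSum _ fun k _ => (integrable_exp_mul _ g).mul_const _)
  simp only [RCLike.re_to_complex] at h
  rw [← h]
  congr 1
  ext θ
  unfold evalE
  rw [Complex.re_sum, Complex.re_sum, Finset.mul_sum]
  refine Finset.sum_congr rfl fun k _ => ?_
  rw [← Complex.re_ofReal_mul, ← Complex.conj_re]
  congr 1
  rw [map_mul, map_mul, ← Complex.exp_conj, map_mul, Complex.conj_ofReal, Complex.conj_ofReal,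
    Complex.conj_I, Complex.conj_conj]
  ring_nf

/-- Negation of frequencies. -/
def negEquiv (hΛ : ∀ k ∈ Λ, -k ∈ Λ) : {k // k ∈ Λ} ≃ {k // k ∈ Λ} :=
  ⟨fun k => ⟨-k.1, hΛ _ k.2⟩, fun k => ⟨-k.1, hΛ _ k.2⟩, fun k => by simp, fun k => by simp⟩

/-- For symmetric coefficients the trigonometric sum is real. -/
lemma ofReal_evalE (hΛ : ∀ k ∈ Λ, -k ∈ Λ) {p : Coeff d Λ} (hp : symmE d Λ p) (θ : Fin d → ℝ) :
    (evalE d Λ p θ : ℂ) =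
      ∑ k : {k // k ∈ Λ}, p k * Complex.exp (-(dotP d (k : Fin d → ℤ) θ : ℂ) * Complex.I) := by
  unfold evalE
  rw [← Complex.conj_eq_iff_re, map_sum]
  rw [← (negEquiv hΛ).sum_comp]
  refine Finset.sum_congr rfl fun k _ => ?_
  have h1 : p (negEquiv hΛ k) = starRingEnd ℂ (p k) := hp k (hΛ _ k.2)
  have h2 : dotP d (negEquiv hΛ k : Fin d → ℤ) θ = -dotP d k θ := dotP_neg_left _ _
  rw [h1, h2, map_mul, Complex.conj_conj, ← Complex.exp_conj, map_mul, map_neg,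
    Complex.conj_ofReal, Complex.conj_I]
  push_cast
  ring_nf

lemma momL_evalL (hΛ : ∀ k ∈ Λ, -k ∈ Λ) {p : Coeff d Λ} (hp : symmE d Λ p) :
    momL d Λ (evalL d Λ p) = p := by
  ext k
  have h1 : ∀ θ : Fin d → ℝ, Complex.exp ((dotP d (k : Fin d → ℤ) θ : ℂ) * Complex.I) *
      (evalE d Λ p θ : ℂ) = ∑ l : {k // k ∈ Λ},
        p l * Complex.exp ((dotP d ((k : Fin d → ℤ) - (l : Fin d → ℤ)) θ : ℂ) * Complex.I) := by
    intro θ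
    rw [ofReal_evalE hΛ hp, Finset.mul_sum]
    refine Finset.sum_congr rfl fun l _ => ?_
    rw [mul_left_comm, ← Complex.exp_add, dotP_sub_left]
    push_cast
    ring_nf
  simp only [momL_apply, evalL_apply, h1]
  rw [integral_finsetSum]
  · simp only [integral_const_mul, integral_exp_dm, sub_eq_zero]
    rw [Finset.sum_eq_single k]
    · simp
    · intro l _ hl
      rw [if_neg fun h => hl (Subtype.ext h.symm), mul_zero]
    · simp
  · intro l _
    have := integrable_exp_mul ((k : Fin d → ℤ) - (l : Fin d → ℤ)) 1
    simp only [BoundedContinuousFunction.coe_one, Pi.one_apply, Complex.ofReal_one, mul_one]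
      at this
    exact this.const_mul _

lemma eq_zero_of_ae_evalE_eq_zero (hΛ : ∀ k ∈ Λ, -k ∈ Λ) {p : Coeff d Λ} (hp : symmE d Λ p)
    (h : ∀ᵐ θ ∂(dm d), evalE d Λ p θ = 0) : p = 0 := by
  rw [← momL_evalL hΛ hp]
  ext k
  rw [momL_apply]
  refine integral_eq_zero_of_ae ?_
  filter_upwards [h] with θ hθ
  simp [hθ]

/-- The integral of a positive function against a nonnegative one vanishes only if the latter does
almost everywhere. -/
lemma ae_eq_zero_of_integral_mul_eq_zero {w u : (Fin d → ℝ) →ᵇ ℝ} (hw : ∀ θ, 0 < w θ)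
    (hu : ∀ θ, 0 ≤ u θ) (h : ∫ θ, w θ * u θ ∂(dm d) = 0) : ∀ᵐ θ ∂(dm d), u θ = 0 := by
  have hi : Integrable (fun θ => w θ * u θ) (dm d) := (w * u).integrable (dm d)
  rw [integral_eq_zero_iff_of_nonneg (fun θ => mul_nonneg (hw θ).le (hu θ)) hi] at h
  filter_upwards [h] with θ hθ
  exact (mul_eq_zero.1 hθ).resolve_left (hw θ).ne'

lemma fpE_eq_momL {P Q : Coeff d Λ} (hQ : Q ∈ posSet d Λ) :
    fpE d Λ P Q = momL d Λ (evalL d Λ P * Ring.inverse (evalL d Λ Q)) := by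
  obtain ⟨u, hu, hinv⟩ := exists_unit_evalL hQ
  rw [← hu, Ring.inverse_unit]
  ext k
  rw [momL_apply]
  simp only [fpE, BoundedContinuousFunction.coe_mul, Pi.mul_apply, hinv, evalL_apply,
    div_eq_mul_inv]

lemma symmE_fpE {P Q : Coeff d Λ} (hQ : Q ∈ posSet d Λ) : symmE d Λ (fpE d Λ P Q) :=
  fpE_eq_momL (P := P) hQ ▸ symmE_momL _

lemma pairE_fpE {P Q : Coeff d Λ} (hQ : Q ∈ posSet d Λ) (p : Coeff d Λ) :
    pairE d Λ (fpE d Λ P Q) p =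
      ∫ θ, evalE d Λ P θ * (evalE d Λ Q θ)⁻¹ * evalE d Λ p θ ∂(dm d) := by
  obtain ⟨u, hu, hinv⟩ := exists_unit_evalL hQ
  rw [fpE_eq_momL hQ, pairE_momL, ← hu, Ring.inverse_unit]
  simp only [BoundedContinuousFunction.coe_mul, Pi.mul_apply, hinv, evalL_apply]

lemma contDiffAt_fpE {P Q : Coeff d Λ} (hQ : Q ∈ posSet d Λ) :
    ContDiffAt ℝ (⊤ : ℕ∞) (fpE d Λ P) Q := by
  obtain ⟨u, hu, hinv⟩ := exists_unit_evalL hQ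
  have h1 : ContDiffAt ℝ (⊤ : ℕ∞)
      (fun q => momL d Λ (evalL d Λ P * Ring.inverse (evalL d Λ q))) Q := by
    refine (momL d Λ).contDiff.contDiffAt.comp Q (contDiffAt_const.mul ?_)
    have := contDiffAt_ringInverse ℝ (n := (⊤ : ℕ∞)) u
    rw [hu] at this
    exact this.comp Q (evalL d Λ).contDiff.contDiffAt
  refine h1.congr_of_eventuallyEq ?_
  filter_upwards [isOpen_posSet.mem_nhds hQ] with q hq
  exact fpE_eq_momL hq

lemma hasFDerivAt_fpE {P Q : Coeff d Λ} (hQ : Q ∈ posSet d Λ) :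
    ∃ D : Coeff d Λ →L[ℝ] Coeff d Λ, HasFDerivAt (fpE d Λ P) D Q ∧
      ∀ h, ∃ g : (Fin d → ℝ) →ᵇ ℝ, D h = momL d Λ g ∧
        ∀ θ, g θ = -(evalE d Λ P θ * (evalE d Λ Q θ)⁻¹ ^ 2 * evalE d Λ h θ) := by
  obtain ⟨u, hu, hinv⟩ := exists_unit_evalL hQ
  have h0 := (hasStrictFDerivAt_ringInverse (𝕜 := ℝ) u).hasFDerivAt
  rw [hu] at h0
  have h1 := (momL d Λ).hasFDerivAt.comp Q
    (((ContinuousLinearMap.mul ℝ ((Fin d → ℝ) →ᵇ ℝ) (evalL d Λ P)).hasFDerivAt).comp Q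
      (h0.comp Q (evalL d Λ).hasFDerivAt))
  refine ⟨_, h1.congr_of_eventuallyEq ?_, ?_⟩
  · filter_upwards [isOpen_posSet.mem_nhds hQ] with q hq
    exact fpE_eq_momL hq
  · intro h
    refine ⟨evalL d Λ P * -((↑u⁻¹ : (Fin d → ℝ) →ᵇ ℝ) * evalL d Λ h * ↑u⁻¹), ?_, ?_⟩
    · have hneg : evalL d Λ P * -((↑u⁻¹ : (Fin d → ℝ) →ᵇ ℝ) * evalL d Λ h * ↑u⁻¹)
          = -(evalL d Λ P * ((↑u⁻¹ : (Fin d → ℝ) →ᵇ ℝ) * evalL d Λ h * ↑u⁻¹)) := by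
        ext θ
        simp
      rw [hneg, map_neg]
      simp
    · intro θ
      simp only [BoundedContinuousFunction.coe_mul, BoundedContinuousFunction.coe_neg,
        Pi.mul_apply, Pi.neg_apply, hinv, evalL_apply]
      ring

lemma fpE_mem_CplusE (hΛ : ∀ k ∈ Λ, -k ∈ Λ) {P Q : Coeff d Λ} (hP : P ∈ posSet d Λ)
    (hQ : Q ∈ posSet d Λ) : fpE d Λ P Q ∈ CplusE d Λ := by
  refine ⟨symmE_fpE hQ, fun p hp hp0 => ?_⟩
  obtain ⟨u, hu, hinv⟩ := exists_unit_evalL hQ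
  have hw : ∀ θ, 0 < (evalL d Λ P * (↑u⁻¹ : (Fin d → ℝ) →ᵇ ℝ)) θ := fun θ => by
    simpa [hinv] using mul_pos (hP θ) (inv_pos.2 (hQ θ))
  rw [fpE_eq_momL hQ, pairE_momL, ← hu, Ring.inverse_unit]
  refine lt_of_le_of_ne (integral_nonneg fun θ =>
    mul_nonneg (hw θ).le (evalE_nonneg_of_mem_PbarE hp θ)) fun h => hp0 ?_
  exact eq_zero_of_ae_evalE_eq_zero hΛ hp.1 (ae_eq_zero_of_integral_mul_eq_zero
    (u := evalL d Λ p) hw (evalE_nonneg_of_mem_PbarE hp) h.symm)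

lemma symmE_sub {p q : Coeff d Λ} (hp : symmE d Λ p) (hq : symmE d Λ q) : symmE d Λ (p - q) := by
  intro k h
  simp [hp k h, hq k h]

lemma evalE_sub (p q : Coeff d Λ) (θ : Fin d → ℝ) :
    evalE d Λ (p - q) θ = evalE d Λ p θ - evalE d Λ q θ := by
  have := evalE_add (p - q) q θ
  rw [sub_add_cancel] at this
  linarith

/-- A positive weighted quadratic form is definite on symmetric coefficients. -/
lemma eq_zero_of_pairE_momL_mul (hΛ : ∀ k ∈ Λ, -k ∈ Λ) {w : (Fin d → ℝ) →ᵇ ℝ} (hw : ∀ θ, 0 < w θ)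
    {h : Coeff d Λ} (hh : symmE d Λ h) (h0 : momL d Λ (w * evalL d Λ h) = 0) : h = 0 := by
  have h1 := pairE_momL (w * evalL d Λ h) h
  rw [h0] at h1
  refine eq_zero_of_ae_evalE_eq_zero hΛ hh ?_
  have h2 := ae_eq_zero_of_integral_mul_eq_zero (u := evalL d Λ h * evalL d Λ h) hw
    (fun θ => mul_self_nonneg _) (by
      rw [show (0 : ℝ) = pairE d Λ 0 h by simp [pairE], h1]
      simp [mul_assoc])
  filter_upwards [h2] with θ hθ
  exact mul_self_eq_zero.1 hθ

lemma injOn_fpE (hΛ : ∀ k ∈ Λ, -k ∈ Λ) {P : Coeff d Λ} (hP : P ∈ posSet d Λ) :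
    Set.InjOn (fpE d Λ P) (PplusE d Λ) := by
  intro q₁ h₁ q₂ h₂ h
  rw [mem_PplusE_iff] at h₁ h₂
  obtain ⟨u₁, hu₁, hinv₁⟩ := exists_unit_evalL h₁.2
  obtain ⟨u₂, hu₂, hinv₂⟩ := exists_unit_evalL h₂.2
  rw [fpE_eq_momL h₁.2, fpE_eq_momL h₂.2, ← hu₁, ← hu₂, Ring.inverse_unit,
    Ring.inverse_unit] at h
  rw [← sub_eq_zero]
  refine eq_zero_of_pairE_momL_mul hΛ
    (w := evalL d Λ P * (↑u₁⁻¹ : (Fin d → ℝ) →ᵇ ℝ) * (↑u₂⁻¹ : (Fin d → ℝ) →ᵇ ℝ))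
    (fun θ => ?_) (symmE_sub h₁.1 h₂.1) ?_
  · simpa [hinv₁, hinv₂] using
      mul_pos (mul_pos (hP θ) (inv_pos.2 (h₁.2 θ))) (inv_pos.2 (h₂.2 θ))
  · rw [← sub_eq_zero.2 h.symm, ← map_sub]
    congr 1
    ext θ
    have e₁ := (h₁.2 θ).ne'
    have e₂ := (h₂.2 θ).ne'
    simp only [BoundedContinuousFunction.coe_mul, BoundedContinuousFunction.coe_sub,
      Pi.mul_apply, Pi.sub_apply, hinv₁, hinv₂, evalL_apply, evalE_sub]
    field_simp

lemma negEquiv_negEquiv (hΛ : ∀ k ∈ Λ, -k ∈ Λ) (k : {k // k ∈ Λ}) :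
    negEquiv hΛ (negEquiv hΛ k) = k := by
  simp [negEquiv]

/-- The projection onto the conjugate-antisymmetric part. -/
def antiL (hΛ : ∀ k ∈ Λ, -k ∈ Λ) : Coeff d Λ →L[ℝ] Coeff d Λ :=
  LinearMap.toContinuousLinearMap
    { toFun := fun p k => (p k - starRingEnd ℂ (p (negEquiv hΛ k))) / 2
      map_add' := fun p q => by
        ext k
        simp only [Pi.add_apply, map_add]
        ring
      map_smul' := fun a p => by
        ext k
        simp only [Pi.smul_apply, Complex.real_smul, map_mul, Complex.conj_ofReal,
          RingHom.id_apply]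
        ring }

lemma antiL_apply (hΛ : ∀ k ∈ Λ, -k ∈ Λ) (p : Coeff d Λ) (k : {k // k ∈ Λ}) :
    antiL hΛ p k = (p k - starRingEnd ℂ (p (negEquiv hΛ k))) / 2 := rfl

lemma antiL_eq_zero_iff (hΛ : ∀ k ∈ Λ, -k ∈ Λ) {p : Coeff d Λ} :
    antiL hΛ p = 0 ↔ symmE d Λ p := by
  constructor
  · intro h k hk
    have := congrFun h k
    rw [antiL_apply, Pi.zero_apply, div_eq_zero_iff, or_iff_left two_ne_zero, sub_eq_zero] at this
    rw [this, Complex.conj_conj]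
    rfl
  · intro h
    ext k
    have : p (negEquiv hΛ k) = starRingEnd ℂ (p k) := h k (hΛ _ k.2)
    simp [antiL_apply, this]

lemma antiL_antiL (hΛ : ∀ k ∈ Λ, -k ∈ Λ) (p : Coeff d Λ) :
    antiL hΛ (antiL hΛ p) = antiL hΛ p := by
  ext k
  simp only [antiL_apply, negEquiv_negEquiv, map_div₀, map_sub, Complex.conj_conj, map_ofNat]
  ring

lemma symmE_sub_antiL (hΛ : ∀ k ∈ Λ, -k ∈ Λ) (p : Coeff d Λ) : symmE d Λ (p - antiL hΛ p) := by
  rw [← antiL_eq_zero_iff hΛ, map_sub, antiL_antiL, sub_self]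

lemma evalE_antiL (hΛ : ∀ k ∈ Λ, -k ∈ Λ) (p : Coeff d Λ) (θ : Fin d → ℝ) :
    evalE d Λ (antiL hΛ p) θ = 0 := by
  have h1 : evalE d Λ (fun k => starRingEnd ℂ (p (negEquiv hΛ k))) θ = evalE d Λ p θ := by
    rw [evalE_eq, evalE_eq, ← (negEquiv hΛ).sum_comp]
    refine Finset.sum_congr rfl fun k _ => ?_
    have : dotP d (negEquiv hΛ k : Fin d → ℤ) θ = -dotP d k θ := dotP_neg_left _ _
    simp [negEquiv_negEquiv, this]
  have h2 : antiL hΛ p = (1 / 2 : ℝ) • (p - fun k => starRingEnd ℂ (p (negEquiv hΛ k))) := by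
    ext k
    simp only [antiL_apply, Pi.smul_apply, Pi.sub_apply, Complex.real_smul]
    push_cast
    ring
  rw [h2, evalE_smul, evalE_sub, h1, sub_self, mul_zero]

lemma evalE_sub_antiL (hΛ : ∀ k ∈ Λ, -k ∈ Λ) (p : Coeff d Λ) :
    evalE d Λ (p - antiL hΛ p) = evalE d Λ p := by
  ext θ
  rw [evalE_sub, evalE_antiL, sub_zero]

/-- The moment map, extended to a local diffeomorphism of the whole coefficient space. -/
def extMap (hΛ : ∀ k ∈ Λ, -k ∈ Λ) (P Q : Coeff d Λ) : Coeff d Λ := fpE d Λ P Q + antiL hΛ Q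

lemma antiL_extMap (hΛ : ∀ k ∈ Λ, -k ∈ Λ) {P Q : Coeff d Λ} (hQ : Q ∈ posSet d Λ) :
    antiL hΛ (extMap hΛ P Q) = antiL hΛ Q := by
  rw [extMap, map_add, antiL_antiL, (antiL_eq_zero_iff hΛ).2 (symmE_fpE hQ), zero_add]

lemma fpE_sub_antiL (hΛ : ∀ k ∈ Λ, -k ∈ Λ) (P Q : Coeff d Λ) :
    fpE d Λ P (Q - antiL hΛ Q) = fpE d Λ P Q := by
  unfold fpE
  rw [evalE_sub_antiL]

lemma contDiffAt_extMap (hΛ : ∀ k ∈ Λ, -k ∈ Λ) {P Q : Coeff d Λ} (hQ : Q ∈ posSet d Λ) :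
    ContDiffAt ℝ (⊤ : ℕ∞) (extMap hΛ P) Q :=
  (contDiffAt_fpE hQ).add (antiL hΛ).contDiff.contDiffAt

lemma hasFDerivAt_extMap (hΛ : ∀ k ∈ Λ, -k ∈ Λ) {P Q : Coeff d Λ} (hP : P ∈ posSet d Λ)
    (hQ : Q ∈ posSet d Λ) : ∃ D : Coeff d Λ ≃L[ℝ] Coeff d Λ,
      HasFDerivAt (extMap hΛ P) (D : Coeff d Λ →L[ℝ] Coeff d Λ) Q := by
  obtain ⟨D, hD, hDg⟩ := hasFDerivAt_fpE (P := P) hQ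
  have hinj : Function.Injective ((D + antiL hΛ : Coeff d Λ →L[ℝ] Coeff d Λ) :
      Coeff d Λ →ₗ[ℝ] Coeff d Λ) := by
    rw [injective_iff_map_eq_zero]
    intro h hh
    obtain ⟨g, hg, hgθ⟩ := hDg h
    have h1 : D h + antiL hΛ h = 0 := hh
    have h2 : antiL hΛ h = 0 := by
      have := congrArg (antiL hΛ) h1
      rwa [map_add, antiL_antiL, map_zero, hg, (antiL_eq_zero_iff hΛ).2 (symmE_momL g),
        zero_add] at this
    rw [h2, add_zero, hg] at h1
    obtain ⟨u, hu, hinv⟩ := exists_unit_evalL hQ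
    refine eq_zero_of_pairE_momL_mul hΛ
      (w := evalL d Λ P * (↑u⁻¹ : (Fin d → ℝ) →ᵇ ℝ) ^ 2)
      (fun θ => ?_) ((antiL_eq_zero_iff hΛ).1 h2) ?_
    · simpa [hinv] using mul_pos (hP θ) (inv_pos.2 (pow_pos (hQ θ) 2))
    · rw [← neg_eq_zero, ← map_neg, ← h1]
      congr 1
      ext θ
      simp [hgθ, hinv]
  refine ⟨(LinearEquiv.ofInjectiveEndo _ hinj).toContinuousLinearEquiv, ?_⟩
  have he : ((LinearEquiv.ofInjectiveEndo _ hinj).toContinuousLinearEquiv :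
      Coeff d Λ →L[ℝ] Coeff d Λ) = D + antiL hΛ := by
    ext1 h
    rfl
  rw [he]
  exact hD.add (antiL hΛ).hasFDerivAt

lemma isOpen_image_extMap (hΛ : ∀ k ∈ Λ, -k ∈ Λ) {P : Coeff d Λ} (hP : P ∈ posSet d Λ) :
    IsOpen (extMap hΛ P '' posSet d Λ) := by
  rw [isOpen_iff_mem_nhds]
  rintro _ ⟨Q, hQ, rfl⟩
  obtain ⟨D, hD⟩ := hasFDerivAt_extMap hΛ hP hQ
  have hs := (contDiffAt_extMap hΛ (P := P) hQ).hasStrictFDerivAt' hD (by simp)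
  rw [← hs.map_nhds_eq_of_equiv]
  exact Filter.image_mem_map (isOpen_posSet.mem_nhds hQ)

/-- Any inverse of the moment map is smooth at the points of its image. -/
lemma contDiffWithinAt_of_leftInvOn (hΛ : ∀ k ∈ Λ, -k ∈ Λ) {P Q : Coeff d Λ}
    (hP : P ∈ posSet d Λ) (hQ : Q ∈ PplusE d Λ) {G : Coeff d Λ → Coeff d Λ}
    (hG : Set.LeftInvOn G (fpE d Λ P) (PplusE d Λ)) :
    ContDiffWithinAt ℝ (⊤ : ℕ∞) G (CplusE d Λ) (fpE d Λ P Q) := by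
  have hQ' := mem_PplusE_iff.1 hQ
  obtain ⟨D, hD⟩ := hasFDerivAt_extMap hΛ hP hQ'.2
  have hc := contDiffAt_extMap hΛ (P := P) hQ'.2
  have hs := hc.hasStrictFDerivAt' hD (by simp)
  have hval : extMap hΛ P Q = fpE d Λ P Q := by
    rw [extMap, (antiL_eq_zero_iff hΛ).2 hQ'.1, add_zero]
  have hinv := hc.to_localInverse hD (by simp)
  have htend := hs.localInverse_tendsto
  have hright := hs.eventually_right_inverse
  rw [hval] at hinv htend hright
  refine hinv.contDiffWithinAt.congr_of_eventuallyEq_of_mem ?_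
    (fpE_mem_CplusE hΛ hP hQ'.2)
  filter_upwards [self_mem_nhdsWithin, nhdsWithin_le_nhds hright,
    nhdsWithin_le_nhds (htend.eventually (isOpen_posSet.mem_nhds hQ'.2))] with c h1 h2 h3
  have h4 : antiL hΛ (hs.localInverse _ _ _ c) = 0 := by
    rw [← antiL_extMap hΛ (P := P) h3, h2, antiL_eq_zero_iff]
    exact h1.1
  have h5 : fpE d Λ P (hs.localInverse _ _ _ c) = c := by
    rwa [extMap, h4, add_zero] at h2
  change G c = hs.localInverse _ _ _ c
  conv_lhs => rw [← h5]
  exact hG (mem_PplusE_iff.2 ⟨(antiL_eq_zero_iff hΛ).1 h4, h3⟩)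

/-- A nonnegative trigonometric polynomial vanishes at least quadratically at its zeros. -/
lemma exists_quadratic_bound {p : Coeff d Λ} (hp : p ∈ PbarE d Λ) {η : Fin d → ℝ}
    (hη : evalE d Λ p η = 0) : ∃ C > 0, ∀ θ, evalE d Λ p θ ≤ C * ‖θ - η‖ ^ 2 := by
  refine ⟨∑ k : {k // k ∈ Λ}, (|(p k).re| + |(p k).im|) * (∑ j, |((k : Fin d → ℤ) j : ℝ)|) ^ 2 + 1,
    by positivity, fun θ => ?_⟩
  obtain ⟨x, rfl⟩ : ∃ x, θ = η + x := ⟨θ - η, by abel⟩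
  have h1 : evalE d Λ p (η + x) ≤
      evalE d Λ p (η + x) + evalE d Λ p (η + -x) - 2 * evalE d Λ p η := by
    have := evalE_nonneg_of_mem_PbarE hp (η + -x)
    rw [hη]
    linarith
  refine h1.trans ?_
  rw [add_sub_cancel_left, add_mul, one_mul]
  refine le_add_of_le_of_nonneg ?_ (by positivity)
  rw [evalE_eq, evalE_eq, evalE_eq, Finset.mul_sum, ← Finset.sum_add_distrib,
    ← Finset.sum_sub_distrib, Finset.sum_mul]
  refine Finset.sum_le_sum fun k _ => ?_
  rw [dotP_add, dotP_add, dotP_neg_right]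
  set a := dotP d k η
  set b := dotP d k x with hb
  rw [← sub_eq_add_neg, Real.cos_add, Real.sin_add, Real.cos_sub, Real.sin_sub]
  have hbx : b ^ 2 ≤ (∑ j, |((k : Fin d → ℤ) j : ℝ)|) ^ 2 * ‖x‖ ^ 2 := by
    rw [← mul_pow, ← sq_abs]
    exact pow_le_pow_left₀ (abs_nonneg _) (abs_dotP_le _ _) 2
  have hcos := Real.one_sub_sq_div_two_le_cos (x := b)
  have hcos1 := Real.cos_le_one b
  have hr : -((p k).re * Real.cos a) ≤ |(p k).re| := by
    refine (neg_le_abs _).trans ?_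
    rw [abs_mul]
    exact mul_le_of_le_one_right (abs_nonneg _) (Real.abs_cos_le_one a)
  have hi : -((p k).im * Real.sin a) ≤ |(p k).im| := by
    refine (neg_le_abs _).trans ?_
    rw [abs_mul]
    exact mul_le_of_le_one_right (abs_nonneg _) (Real.abs_sin_le_one a)
  have h2 : -((p k).re * Real.cos a + (p k).im * Real.sin a) * (2 * (1 - Real.cos b)) ≤
      (|(p k).re| + |(p k).im|) * (2 * (1 - Real.cos b)) := by
    refine mul_le_mul_of_nonneg_right (by linarith) (by linarith)
  have h3 : (|(p k).re| + |(p k).im|) * (2 * (1 - Real.cos b)) ≤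
      (|(p k).re| + |(p k).im|) * ((∑ j, |((k : Fin d → ℤ) j : ℝ)|) ^ 2 * ‖x‖ ^ 2) := by
    refine mul_le_mul_of_nonneg_left (by linarith) (by positivity)
  linarith

/-- In dimension at most two, the inverse square of the distance to a point of the cell is not
integrable on the cell. -/
lemma setLIntegral_inv_sq_norm_eq_top (hd1 : 1 ≤ d) (hd2 : d ≤ 2) {η : Fin d → ℝ}
    (hη : η ∈ Td d) : ∫⁻ θ in Td d, (ENNReal.ofReal (‖θ - η‖ ^ 2))⁻¹ = ⊤ := by
  by_contra hfin
  set g : (Fin d → ℝ) → ENNReal := fun x => (ENNReal.ofReal (‖x‖ ^ 2))⁻¹ with hg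
  have hgm : Measurable g := by fun_prop
  set K : Set (Fin d → ℝ) := {x | x + η ∈ Td d} with hK
  have hKm : MeasurableSet K := measurableSet_Td.preimage (measurable_add_const η)
  set H : Set (Fin d → ℝ) := (fun x => (2 : ℝ) • x) ⁻¹' K with hH
  have hHm : MeasurableSet H := hKm.preimage (measurable_const_smul _)
  have hI : ∫⁻ θ in Td d, g (θ - η) = ∫⁻ x in K, g x := by
    rw [← lintegral_indicator measurableSet_Td, ← lintegral_indicator hKm,
      ← lintegral_add_right_eq_self _ η]
    refine lintegral_congr fun x => ?_
    by_cases hx : x ∈ K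
    · rw [Set.indicator_of_mem hx, Set.indicator_of_mem (show x + η ∈ Td d from hx),
        add_sub_cancel_right]
    · rw [Set.indicator_of_notMem hx, Set.indicator_of_notMem (show x + η ∉ Td d from hx)]
  have hfinK : ∫⁻ x in K, g x ≠ ⊤ := hI ▸ hfin
  have hHK : H ⊆ K := by
    intro x hx j _
    have h1 := hx j trivial
    have h2 := hη j trivial
    simp only [Pi.add_apply, Pi.smul_apply, smul_eq_mul, Set.mem_Ioc] at h1 h2 ⊢
    constructor <;> linarith
  have hscale : ∀ x, g x = 4 * g ((2 : ℝ) • x) := by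
    intro x
    simp only [hg]
    rw [norm_smul, mul_pow, ENNReal.ofReal_mul (by positivity),
      ENNReal.mul_inv (by left; simp) (by left; simp), ← mul_assoc]
    have : ENNReal.ofReal (‖(2 : ℝ)‖ ^ 2) = 4 := by norm_num
    rw [this, ENNReal.mul_inv_cancel (by norm_num) (by norm_num), one_mul]
  have hpow : (4 : ENNReal)⁻¹ ≤ ENNReal.ofReal |((2 : ℝ) ^ d)⁻¹| := by
    rw [abs_of_nonneg (by positivity), ENNReal.ofReal_inv_of_pos (by positivity)]
    refine ENNReal.inv_le_inv.2 (ENNReal.ofReal_le_of_le_toReal ?_)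
    calc (2 : ℝ) ^ d ≤ 2 ^ 2 := pow_le_pow_right₀ one_le_two hd2
      _ = _ := by norm_num
  have hint : ∫⁻ x in K, g x ≤ ∫⁻ x in H, g x := by
    have h1 : ∫⁻ x in H, g x = 4 * ∫⁻ x, K.indicator g ((2 : ℝ) • x) := by
      have hm : Measurable fun x : Fin d → ℝ => K.indicator g ((2 : ℝ) • x) :=
        (hgm.indicator hKm).comp (measurable_const_smul _)
      rw [← lintegral_indicator hHm, ← lintegral_const_mul _ hm]
      refine lintegral_congr fun x => ?_
      by_cases hx : x ∈ H
      · rw [Set.indicator_of_mem hx, Set.indicator_of_mem (show (2 : ℝ) • x ∈ K from hx), hscale]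
      · rw [Set.indicator_of_notMem hx, Set.indicator_of_notMem (show (2 : ℝ) • x ∉ K from hx),
          mul_zero]
    have h2 : ∫⁻ x, K.indicator g ((2 : ℝ) • x) =
        ENNReal.ofReal |((2 : ℝ) ^ d)⁻¹| * ∫⁻ x in K, g x := by
      rw [← lintegral_map (hgm.indicator hKm) (measurable_const_smul (2 : ℝ)),
        Measure.map_addHaar_smul volume two_ne_zero, lintegral_smul_measure,
        lintegral_indicator hKm, Module.finrank_fin_fun, smul_eq_mul]
    rw [h1, h2, ← mul_assoc]
    refine le_mul_of_one_le_left zero_le ?_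
    calc (1 : ENNReal) = 4 * 4⁻¹ := (ENNReal.mul_inv_cancel (by norm_num) (by norm_num)).symm
      _ ≤ _ := by gcongr
  have hdiff : ∫⁻ x in K \ H, g x = 0 := by
    have hsum : (∫⁻ x in H, g x) + ∫⁻ x in K \ H, g x = ∫⁻ x in K, g x := by
      have := lintegral_inter_add_sdiff (μ := volume) g K hHm
      rwa [Set.inter_eq_self_of_subset_right hHK] at this
    have h1 : (∫⁻ x in K, g x) + ∫⁻ x in K \ H, g x ≤ (∫⁻ x in K, g x) + 0 := by
      rw [add_zero]
      exact (add_le_add_left hint _).trans hsum.le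
    exact le_antisymm ((ENNReal.add_le_add_iff_left hfinK).1 h1) zero_le
  have hnull : volume (K \ H) = 0 := by
    rw [setLIntegral_eq_zero_iff (hKm.diff hHm) hgm] at hdiff
    have : ∀ᵐ x, x ∉ K \ H := by
      filter_upwards [hdiff] with x hx hmem
      have := hx hmem
      simp [hg] at this
    exact measure_eq_zero_iff_ae_notMem.2 this
  have hvolK : volume K = ENNReal.ofReal ((2 * Real.pi) ^ d) := by
    rw [hK, ← volume_Td]
    exact measure_preimage_add_right volume η (Td d)
  have hvolH : volume H = ENNReal.ofReal |((2 : ℝ) ^ d)⁻¹| * volume K := by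
    rw [hH, Measure.addHaar_preimage_smul volume two_ne_zero, Module.finrank_fin_fun]
  have hlt : volume H < volume K := by
    rw [hvolH, hvolK, ← ENNReal.ofReal_mul (abs_nonneg _)]
    refine (ENNReal.ofReal_lt_ofReal_iff (by positivity)).2 ?_
    rw [abs_of_nonneg (by positivity)]
    refine mul_lt_of_lt_one_left (by positivity) (inv_lt_one_of_one_lt₀ ?_)
    exact one_lt_pow₀ one_lt_two (by omega)
  have hle : volume K ≤ volume H := by
    calc volume K ≤ volume (H ∪ K \ H) := measure_mono (by simp)
      _ ≤ volume H + volume (K \ H) := measure_union_le _ _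
      _ = volume H := by rw [hnull, add_zero]
  exact absurd hle (not_le.2 hlt)

lemma pairE_add_left (c c' p : Coeff d Λ) :
    pairE d Λ (c + c') p = pairE d Λ c p + pairE d Λ c' p := by
  simp [pairE, add_mul, Finset.sum_add_distrib]

lemma pairE_smul_left (a : ℝ) (c p : Coeff d Λ) :
    pairE d Λ (a • c) p = a * pairE d Λ c p := by
  unfold pairE
  rw [← Complex.re_ofReal_mul, Finset.mul_sum]
  simp [mul_assoc]

lemma pairE_smul_right (a : ℝ) (c p : Coeff d Λ) :
    pairE d Λ c (a • p) = a * pairE d Λ c p := by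
  unfold pairE
  rw [← Complex.re_ofReal_mul, Finset.mul_sum]
  simp [mul_left_comm]

lemma continuous_pairE_uncurry :
    Continuous fun x : Coeff d Λ × Coeff d Λ => pairE d Λ x.1 x.2 := by
  unfold pairE
  refine Complex.continuous_re.comp (continuous_finsetSum _ fun k _ => ?_)
  exact ((continuous_apply k).comp continuous_fst).mul
    (Complex.continuous_conj.comp ((continuous_apply k).comp continuous_snd))

lemma symmE_smul (a : ℝ) {p : Coeff d Λ} (hp : symmE d Λ p) : symmE d Λ (a • p) := by
  intro k h
  simp [hp k h]

lemma symmE_add {p q : Coeff d Λ} (hp : symmE d Λ p) (hq : symmE d Λ q) : symmE d Λ (p + q) := by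
  intro k h
  simp [hp k h, hq k h]

lemma convex_CplusE : Convex ℝ (CplusE d Λ) := by
  refine convex_iff_forall_pos.2 fun c hc c' hc' a b ha hb _ => ?_
  refine ⟨symmE_add (symmE_smul a hc.1) (symmE_smul b hc'.1), fun p hp hp0 => ?_⟩
  rw [pairE_add_left, pairE_smul_left, pairE_smul_left]
  exact add_pos (mul_pos ha (hc.2 p hp hp0)) (mul_pos hb (hc'.2 p hp hp0))

lemma isClosed_PbarE : IsClosed (PbarE d Λ) := by
  have h1 : IsClosed {p : Coeff d Λ | symmE d Λ p} := by
    simp only [symmE, Set.ofPred_forall]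
    exact isClosed_iInter fun k => isClosed_iInter fun h =>
      isClosed_eq (by fun_prop) (Complex.continuous_conj.comp (continuous_apply k))
  have h2 : IsClosed {p : Coeff d Λ | ∀ θ ∈ Td d, 0 ≤ evalE d Λ p θ} := by
    simp only [Set.ofPred_forall]
    exact isClosed_iInter fun θ => isClosed_iInter fun _ =>
      isClosed_le continuous_const (continuous_evalE_left θ)
  exact h1.inter h2

lemma PplusE_subset_PbarE : PplusE d Λ ⊆ PbarE d Λ := fun _ hp => ⟨hp.1, fun θ hθ => (hp.2 θ hθ).le⟩

/-- Vectors of the dual cone are coercive, locally uniformly. -/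
lemma eventually_coercive {c : Coeff d Λ} (hc : c ∈ CplusE d Λ) :
    ∃ ε > 0, ∀ᶠ c' in 𝓝 c, ∀ p ∈ PbarE d Λ, ε * ‖p‖ ≤ pairE d Λ c' p := by
  have hS : IsCompact (PbarE d Λ ∩ Metric.sphere 0 1) :=
    (isCompact_sphere _ _).inter_left isClosed_PbarE
  have hcont : Continuous (pairE d Λ c) :=
    continuous_pairE_uncurry.comp (by fun_prop : Continuous fun p : Coeff d Λ => (c, p))
  obtain ⟨m, hm, hmS⟩ := hS.exists_forall_le' hcont.continuousOn (a := 0) fun p hp =>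
    hc.2 p hp.1 (ne_zero_of_mem_unit_sphere ⟨p, hp.2⟩)
  refine ⟨m / 2, half_pos hm, ?_⟩
  have hev := hS.eventually_forall_of_forall_eventually (x₀ := c)
    (P := fun c' p => m / 2 < pairE d Λ c' p) fun p hp =>
      (continuous_pairE_uncurry.tendsto (c, p)).eventually
        (lt_mem_nhds ((half_lt_self hm).trans_le (hmS p hp)))
  filter_upwards [hev] with c' hc' p hp
  rcases eq_or_ne p 0 with rfl | hp0
  · simp [pairE]
  have hn : 0 < ‖p‖ := norm_pos_iff.2 hp0
  have hmem : ‖p‖⁻¹ • p ∈ PbarE d Λ := ⟨symmE_smul _ hp.1, fun θ hθ => by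
    rw [evalE_smul]
    exact mul_nonneg (inv_nonneg.2 hn.le) (hp.2 θ hθ)⟩
  have := hc' (‖p‖⁻¹ • p) ⟨hmem, by simp [norm_smul, hn.ne']⟩
  rw [pairE_smul_right, inv_mul_eq_div, lt_div_iff₀ hn] at this
  exact this.le

lemma lintegral_inv_le {P Q : Coeff d Λ} {m : ℝ} (hm : 0 < m) (hmP : ∀ θ, m ≤ evalE d Λ P θ)
    (hQ : Q ∈ posSet d Λ) : ∫⁻ θ, (ENNReal.ofReal (evalE d Λ Q θ))⁻¹ ∂(dm d) ≤
      ENNReal.ofReal ((m ^ 2)⁻¹ * pairE d Λ (fpE d Λ P Q) P) := by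
  obtain ⟨u, hu, hinv⟩ := exists_unit_evalL hQ
  have hint : Integrable (fun θ => (m ^ 2)⁻¹ *
      (evalE d Λ P θ * (evalE d Λ Q θ)⁻¹ * evalE d Λ P θ)) (dm d) := by
    have := ((evalL d Λ P * (↑u⁻¹ : (Fin d → ℝ) →ᵇ ℝ) * evalL d Λ P).integrable
      (dm d)).const_mul (m ^ 2)⁻¹
    simpa only [BoundedContinuousFunction.coe_mul, Pi.mul_apply, hinv, evalL_apply] using this
  have hpos : ∀ θ, 0 ≤ (m ^ 2)⁻¹ * (evalE d Λ P θ * (evalE d Λ Q θ)⁻¹ * evalE d Λ P θ) :=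
    fun θ => by
      have h1 := hm.trans_le (hmP θ)
      have h2 := hQ θ
      positivity
  rw [pairE_fpE hQ, ← integral_const_mul, ofReal_integral_eq_lintegral_ofReal hint
    (Filter.Eventually.of_forall hpos)]
  refine lintegral_mono fun θ => ?_
  rw [← ENNReal.ofReal_inv_of_pos (hQ θ)]
  refine ENNReal.ofReal_le_ofReal ?_
  have h1 : m ^ 2 ≤ evalE d Λ P θ * evalE d Λ P θ := by
    rw [sq]
    exact mul_self_le_mul_self hm.le (hmP θ)
  rw [mul_right_comm, ← mul_assoc]
  refine le_mul_of_one_le_left (inv_nonneg.2 (hQ θ).le) ?_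
  rw [inv_mul_eq_div, one_le_div (by positivity)]
  exact h1

/-- In dimension at most two, a nonnegative trigonometric polynomial with integrable inverse has
no zeros. -/
lemma mem_posSet_of_lintegral_inv_ne_top (hd1 : 1 ≤ d) (hd2 : d ≤ 2) {Q : Coeff d Λ}
    (hQ : Q ∈ PbarE d Λ) (h : ∫⁻ θ, (ENNReal.ofReal (evalE d Λ Q θ))⁻¹ ∂(dm d) ≠ ⊤) :
    Q ∈ posSet d Λ := by
  refine mem_posSet_of_Td fun η hη => lt_of_le_of_ne (hQ.2 η hη) fun h0 => h ?_
  obtain ⟨C, hC, hb⟩ := exists_quadratic_bound hQ h0.symm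
  rw [dm, lintegral_smul_measure, smul_eq_mul]
  refine ENNReal.mul_eq_top.2 (Or.inl ⟨by simp, ?_⟩)
  rw [eq_top_iff]
  calc (⊤ : ENNReal) = (ENNReal.ofReal C)⁻¹ *
        ∫⁻ θ in Td d, (ENNReal.ofReal (‖θ - η‖ ^ 2))⁻¹ := by
        rw [setLIntegral_inv_sq_norm_eq_top hd1 hd2 hη, ENNReal.mul_top (by simp)]
    _ = ∫⁻ θ in Td d, (ENNReal.ofReal C)⁻¹ * (ENNReal.ofReal (‖θ - η‖ ^ 2))⁻¹ := by
        rw [lintegral_const_mul _ (by fun_prop)]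
    _ ≤ _ := by
        refine lintegral_mono fun θ => ?_
        rw [← ENNReal.mul_inv (by left; simpa using hC) (by left; simp),
          ← ENNReal.ofReal_mul hC.le]
        exact ENNReal.inv_le_inv.2 (ENNReal.ofReal_le_ofReal (hb θ))

/-- The image of the moment map is closed in the dual cone. -/
lemma exists_preimage_of_tendsto (hd1 : 1 ≤ d) (hd2 : d ≤ 2) {P : Coeff d Λ}
    (hP : P ∈ posSet d Λ) {q : ℕ → Coeff d Λ} (hq : ∀ n, q n ∈ PplusE d Λ) {c : Coeff d Λ}
    (hc : c ∈ CplusE d Λ) (hlim : Filter.Tendsto (fun n => fpE d Λ P (q n)) Filter.atTop (𝓝 c)) :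
    ∃ Q ∈ PplusE d Λ, fpE d Λ P Q = c := by
  have hq' := fun n => (mem_PplusE_iff.1 (hq n)).2
  obtain ⟨ε, hε, hev⟩ := eventually_coercive hc
  have hbd : ∀ᶠ n in Filter.atTop, q n ∈
      Metric.closedBall (0 : Coeff d Λ) ((∫ θ, evalE d Λ P θ ∂(dm d)) / ε) := by
    filter_upwards [hlim.eventually hev] with n hn
    have h1 := hn (q n) (PplusE_subset_PbarE (hq n))
    rw [pairE_fpE (hq' n)] at h1
    have h2 : ∀ θ, evalE d Λ P θ * (evalE d Λ (q n) θ)⁻¹ * evalE d Λ (q n) θ = evalE d Λ P θ :=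
      fun θ => inv_mul_cancel_right₀ (hq' n θ).ne' _
    simp only [h2] at h1
    rw [mem_closedBall_zero_iff, le_div_iff₀ hε]
    linarith
  obtain ⟨Q, -, φ, hφ, hQ⟩ :=
    tendsto_subseq_of_frequently_bounded Metric.isBounded_closedBall hbd.frequently
  have hQbar : Q ∈ PbarE d Λ := isClosed_PbarE.mem_of_tendsto hQ
    (Filter.Eventually.of_forall fun n => PplusE_subset_PbarE (hq _))
  have hlim' : Filter.Tendsto (fun n => fpE d Λ P (q (φ n))) Filter.atTop (𝓝 c) :=
    hlim.comp hφ.tendsto_atTop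
  obtain ⟨m, hm, hmP⟩ := exists_lower_bound hP
  have hpt : ∀ θ, Filter.Tendsto (fun n => (ENNReal.ofReal (evalE d Λ (q (φ n)) θ))⁻¹)
      Filter.atTop (𝓝 (ENNReal.ofReal (evalE d Λ Q θ))⁻¹) := fun θ => by
    have h1 : Filter.Tendsto (fun n => evalE d Λ (q (φ n)) θ) Filter.atTop
        (𝓝 (evalE d Λ Q θ)) := ((continuous_evalE_left θ).tendsto Q).comp hQ
    exact (ENNReal.tendsto_ofReal h1).inv
  have hbound : Filter.Tendsto (fun n => ENNReal.ofReal
      ((m ^ 2)⁻¹ * pairE d Λ (fpE d Λ P (q (φ n))) P)) Filter.atTop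
      (𝓝 (ENNReal.ofReal ((m ^ 2)⁻¹ * pairE d Λ c P))) := by
    refine ENNReal.tendsto_ofReal (Filter.Tendsto.const_mul _ ?_)
    have hcont : Continuous fun c' : Coeff d Λ => pairE d Λ c' P :=
      continuous_pairE_uncurry.comp (by fun_prop : Continuous fun c' : Coeff d Λ => (c', P))
    exact (hcont.tendsto c).comp hlim'
  have hfatou : ∫⁻ θ, (ENNReal.ofReal (evalE d Λ Q θ))⁻¹ ∂(dm d) ≤
      ENNReal.ofReal ((m ^ 2)⁻¹ * pairE d Λ c P) := by
    have h1 := lintegral_liminf_le (μ := dm d) (u := Filter.atTop)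
      (f := fun n θ => (ENNReal.ofReal (evalE d Λ (q (φ n)) θ))⁻¹)
      fun n => ((continuous_evalE _).measurable.ennreal_ofReal).inv
    simp only [fun θ => (hpt θ).liminf_eq] at h1
    refine h1.trans ?_
    rw [← hbound.liminf_eq]
    exact Filter.liminf_le_liminf (Filter.Eventually.of_forall fun n =>
      lintegral_inv_le hm hmP (hq' _))
  have hQpos : Q ∈ posSet d Λ :=
    mem_posSet_of_lintegral_inv_ne_top hd1 hd2 hQbar (ne_top_of_le_ne_top (by simp) hfatou)
  refine ⟨Q, mem_PplusE_iff.2 ⟨hQbar.1, hQpos⟩, ?_⟩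
  exact tendsto_nhds_unique
    (((contDiffAt_fpE (P := P) hQpos).continuousAt.tendsto).comp hQ) hlim'

lemma sub_antiL_mem_PplusE (hΛ : ∀ k ∈ Λ, -k ∈ Λ) {Q : Coeff d Λ} (hQ : Q ∈ posSet d Λ) :
    Q - antiL hΛ Q ∈ PplusE d Λ :=
  mem_PplusE_iff.2 ⟨symmE_sub_antiL hΛ Q, fun θ => by
    rw [evalE_sub_antiL]
    exact hQ θ⟩

lemma surjOn_fpE (hd1 : 1 ≤ d) (hd2 : d ≤ 2) (hΛ : ∀ k ∈ Λ, -k ∈ Λ) {P : Coeff d Λ}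
    (hP : P ∈ PplusE d Λ) : Set.SurjOn (fpE d Λ P) (PplusE d Λ) (CplusE d Λ) := by
  have hP' := (mem_PplusE_iff.1 hP).2
  have hmem : ∀ Q ∈ PplusE d Λ, fpE d Λ P Q ∈ extMap hΛ P '' posSet d Λ := fun Q hQ =>
    ⟨Q, (mem_PplusE_iff.1 hQ).2, by
      rw [extMap, (antiL_eq_zero_iff hΛ).2 hQ.1, add_zero]⟩
  have hsub : CplusE d Λ ⊆ extMap hΛ P '' posSet d Λ := by
    refine convex_CplusE.isPreconnected.subset_of_closure_inter_subset
      (isOpen_image_extMap hΛ hP') ⟨_, fpE_mem_CplusE hΛ hP' hP', hmem P hP⟩ ?_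
    rintro c ⟨hcl, hc⟩
    obtain ⟨x, hx, hxc⟩ := mem_closure_iff_seq_limit.1 hcl
    choose q hq hqx using hx
    obtain ⟨Q, hQ, rfl⟩ := exists_preimage_of_tendsto hd1 hd2 hP'
      (q := fun n => q n - antiL hΛ (q n)) (fun n => sub_antiL_mem_PplusE hΛ (hq n)) hc (by
        have h1 : ∀ n, fpE d Λ P (q n - antiL hΛ (q n)) = x n - antiL hΛ (x n) := fun n => by
          rw [fpE_sub_antiL, ← hqx, antiL_extMap hΛ (hq n), extMap, add_sub_cancel_right]
        simp only [h1]
        have h2 := hxc.sub (((antiL hΛ).continuous.tendsto c).comp hxc)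
        rwa [(antiL_eq_zero_iff hΛ).2 hc.1, sub_zero] at h2)
    exact hmem Q hQ
  intro c hc
  obtain ⟨Q, hQ, rfl⟩ := hsub hc
  have h0 : antiL hΛ Q = 0 := by
    rw [← antiL_extMap hΛ (P := P) hQ, antiL_eq_zero_iff]
    exact hc.1
  refine ⟨Q, mem_PplusE_iff.2 ⟨(antiL_eq_zero_iff hΛ).1 h0, hQ⟩, ?_⟩
  rw [extMap, h0, add_zero]

/-- for d ≤ 2 and fixed P ∈ 𝔓₊, the moment map f^p is a smooth
bijection from 𝔓₊ onto ℭ₊ with smooth inverse (a diffeomorphism), the cones being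
regarded inside the finite-dimensional coefficient space indexed by Λ. -/
theorem statement12 (d : ℕ) (hd1 : 1 ≤ d) (hd2 : d ≤ 2) (Λ : Finset (Fin d → ℤ))
    (h0 : (0 : Fin d → ℤ) ∈ Λ) (hΛ : ∀ k ∈ Λ, -k ∈ Λ)
    (P : {k // k ∈ Λ} → ℂ) (hP : P ∈ PplusE d Λ) :
    Set.BijOn (fpE d Λ P) (PplusE d Λ) (CplusE d Λ) ∧
    ContDiffOn ℝ (⊤ : ℕ∞) (fpE d Λ P) (PplusE d Λ) ∧
    ∃ G : ({k // k ∈ Λ} → ℂ) → ({k // k ∈ Λ} → ℂ),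
      Set.InvOn G (fpE d Λ P) (PplusE d Λ) (CplusE d Λ) ∧
      ContDiffOn ℝ (⊤ : ℕ∞) G (CplusE d Λ) := by
  have hP' := (mem_PplusE_iff.1 hP).2
  have hbij : Set.BijOn (fpE d Λ P) (PplusE d Λ) (CplusE d Λ) :=
    ⟨fun Q hQ => fpE_mem_CplusE hΛ hP' (mem_PplusE_iff.1 hQ).2, injOn_fpE hΛ hP',
      surjOn_fpE hd1 hd2 hΛ hP⟩
  have hinv := hbij.invOn_invFunOn
  refine ⟨hbij, fun Q hQ => (contDiffAt_fpE (mem_PplusE_iff.1 hQ).2).contDiffWithinAt,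
    Function.invFunOn (fpE d Λ P) (PplusE d Λ), hinv, fun c hc => ?_⟩
  obtain ⟨Q, hQ, rfl⟩ := hbij.surjOn hc
  exact contDiffWithinAt_of_leftInvOn hΛ hP' hQ hinv.1

end RCE
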